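/- For every n ∈ ℕ the expansion x^n = ∑_{k=0}^{n} B_{n,k}(t,q) Q_k(x,t,q) holds in ℚ(q)[t,x], and moreover B_{n,0}(t,q) = (1/[n+1]) ∑_{j=0}^{n} q^{j²} [n+1 choose j]_q [n+1 choose j+1]_q t^j. -/

import Mathlib

open Finset Polynomial

/-- The field `ℚ(q)` of rational functions. -/
noncomputable abbrev K : Type := RatFunc ℚ

/-- The indeterminate `q`, viewed in `ℚ(q)`. -/
noncomputable def q : K := RatFunc.X

/-- `[n] = (1 - q^n)/(1 - q)` in `ℚ(q)`. -/
noncomputable def qint (n : ℕ) : K := (1 - q ^ n) / (1 - q)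

/-- The Gaussian binomial coefficient `[n choose k]_q` in `ℚ(q)`. -/
noncomputable def qbinom (n k : ℤ) : K :=
  if 0 ≤ k ∧ k ≤ n then
    ∏ i ∈ Finset.range k.toNat, (1 - q ^ (n - k + (i : ℤ) + 1)) / (1 - q ^ ((i : ℤ) + 1))
  else if k = 0 then 1 else 0

/-- `Q_n(x,t,q) = ∑_{k=0}^{n} (−1)^k q^{k(k−1)/2}
(∑_{j=0}^{k} [n−j choose k−j][n−k+j choose j] (q^{n−k+1} t)^j) x^{n−k}`, viewed in
`ℚ(q)[t][x]` (the outer variable is `x`, the inner one is `t`). -/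
noncomputable def polyQ (n : ℕ) : Polynomial (Polynomial K) :=
  ∑ k ∈ Finset.range (n + 1),
    Polynomial.C (((-1 : K) ^ k * q ^ (k * (k - 1) / 2)) •
      ∑ j ∈ Finset.range (k + 1),
        Polynomial.C (qbinom ((n : ℤ) - j) ((k : ℤ) - j) * qbinom ((n : ℤ) - k + j) j *
            q ^ ((n - k + 1) * j)) *
          Polynomial.X ^ j) *
      Polynomial.X ^ (n - k)

/-- `B_{n,k}(t,q) = q^{−(n−k)} ∑_{j=0}^{n−k} q^{j²+j+kj}
([n choose j][n+1 choose k+j+1] − [n+1 choose j][n choose k+j+1]) t^j ∈ ℚ(q)[t]`. -/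
noncomputable def coeffB (n k : ℕ) : Polynomial K :=
  (q ^ (-((n : ℤ) - k))) •
    ∑ j ∈ Finset.range (n - k + 1),
      Polynomial.C (q ^ (j ^ 2 + j + k * j) *
        (qbinom n j * qbinom ((n : ℤ) + 1) ((k : ℤ) + j + 1) -
         qbinom ((n : ℤ) + 1) j * qbinom n ((k : ℤ) + j + 1))) * Polynomial.X ^ j

theorem q_ne_zero : q ≠ 0 := RatFunc.X_ne_zero

theorem q_pow_ne_one {n : ℕ} (hn : n ≠ 0) : q ^ n ≠ 1 := by
  intro h
  have h1 : algebraMap ℚ[X] K (X ^ n) = algebraMap ℚ[X] K 1 := by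
    simpa [q, RatFunc.algebraMap_X] using h
  have h2 := congrArg natDegree (RatFunc.algebraMap_injective ℚ h1)
  simp [hn] at h2

theorem one_sub_q_pow_ne_zero (n : ℕ) : 1 - q ^ (n + 1) ≠ 0 :=
  sub_ne_zero.mpr (q_pow_ne_one n.succ_ne_zero).symm

theorem qbinom_of_neg (n : ℤ) {k : ℤ} (hk : k < 0) : qbinom n k = 0 := by
  rw [qbinom, if_neg (by omega), if_neg (by omega)]

theorem qbinom_of_lt {n k : ℤ} (hn : 0 ≤ n) (hk : n < k) : qbinom n k = 0 := by
  rw [qbinom, if_neg (by omega), if_neg (by omega)]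

@[simp]
theorem qbinom_zero_right (n : ℤ) : qbinom n 0 = 1 := by
  simp [qbinom]

theorem qbinom_self (n : ℕ) : qbinom n n = 1 := by
  rw [qbinom, if_pos (by omega)]
  refine prod_eq_one fun i _ => ?_
  rw [sub_self, zero_add, ← Nat.cast_succ, zpow_natCast]
  exact div_self (one_sub_q_pow_ne_zero i)

theorem qbinom_nat_eq_prod (n k : ℕ) :
    qbinom n k = ∏ i ∈ range k, (q ^ i - q ^ n) / (q ^ i * (1 - q ^ (i + 1))) := by
  by_cases hk : k ≤ n
  · rw [qbinom, if_pos (by omega), prod_div_distrib, Int.toNat_natCast,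
      ← prod_range_reflect (fun i : ℕ => 1 - q ^ ((n : ℤ) - k + i + 1)), ← prod_div_distrib]
    refine prod_congr rfl fun i hi => ?_
    have hi := mem_range.mp hi
    have hq := pow_ne_zero i q_ne_zero
    have := one_sub_q_pow_ne_zero i
    rw [show (n : ℤ) - k + ((k - 1 - i : ℕ) : ℤ) + 1 = n - i by omega, zpow_sub₀ q_ne_zero,
      zpow_natCast, zpow_natCast, ← Nat.cast_succ, zpow_natCast, Nat.succ_eq_add_one]
    field_simp
  · rw [qbinom_of_lt (by omega) (by omega)]
    exact (prod_eq_zero (mem_range.mpr (by omega : n < k)) (by simp)).symm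

/-- Ratio of two Gaussian binomials that are neighbours in a row. -/
theorem qbinom_mul_pow_sub (n k : ℕ) :
    qbinom n k * (q ^ k - q ^ n) = qbinom n ((k : ℤ) + 1) * (q ^ k * (1 - q ^ (k + 1))) := by
  have h := qbinom_nat_eq_prod n (k + 1)
  push_cast at h
  have := one_sub_q_pow_ne_zero k
  have := pow_ne_zero k q_ne_zero
  rw [h, qbinom_nat_eq_prod, prod_range_succ]
  field_simp

/-- Ratio of two Gaussian binomials that are neighbours on a diagonal. -/
theorem one_sub_mul_qbinom_succ (r i : ℕ) :
    (1 - q ^ (i + 1)) * qbinom ((r : ℤ) + i + 1) ((i : ℤ) + 1) =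
      (1 - q ^ (r + i + 1)) * qbinom ((r : ℤ) + i) i := by
  have := one_sub_q_pow_ne_zero i
  rw [qbinom, if_pos (by omega), qbinom, if_pos (by omega),
    show ((i : ℤ) + 1).toNat = i + 1 by omega, Int.toNat_natCast, prod_range_succ,
    show (r : ℤ) + i + 1 - (i + 1) = r + i - i by ring,
    show (r : ℤ) + i - i + i + 1 = ((r + i + 1 : ℕ) : ℤ) by push_cast; ring,
    show (i : ℤ) + 1 = ((i + 1 : ℕ) : ℤ) by push_cast; ring, zpow_natCast, zpow_natCast]
  field_simp

theorem pow_sub_mul_qbinom_sub (r m j : ℕ) :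
    (q ^ j - q ^ (m + 1)) * qbinom ((r : ℤ) + (m + 1 : ℕ) - j) (((m + 1 : ℕ) : ℤ) - j) =
      (q ^ j - q ^ (r + m + 1)) * qbinom ((r : ℤ) + m - j) ((m : ℤ) - j) := by
  rcases lt_trichotomy j (m + 1) with h | rfl | h
  · obtain ⟨i, rfl⟩ := Nat.exists_eq_add_of_le (Nat.le_of_lt_succ h)
    have := one_sub_mul_qbinom_succ r i
    rw [show (r : ℤ) + (j + i + 1 : ℕ) - j = r + i + 1 by push_cast; ring,
      show ((j + i + 1 : ℕ) : ℤ) - j = i + 1 by push_cast; ring,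
      show (r : ℤ) + (j + i : ℕ) - j = r + i by push_cast; ring,
      show ((j + i : ℕ) : ℤ) - j = i by push_cast; ring]
    linear_combination q ^ j * this
  · rw [qbinom_of_neg ((r : ℤ) + m - (m + 1 : ℕ)) (by omega)]
    ring
  · rw [qbinom_of_neg _ (by omega), qbinom_of_neg _ (by omega)]
    ring

/-- The Pascal recurrence for Gaussian binomials. -/
theorem qbinom_succ_succ (n k : ℕ) :
    q ^ k * qbinom ((n : ℤ) + 1) ((k : ℤ) + 1) =
      q ^ k * qbinom n ((k : ℤ) + 1) + q ^ n * qbinom n k := by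
  rcases le_or_gt k n with h | h
  · obtain ⟨r, rfl⟩ := Nat.exists_eq_add_of_le' h
    have h1 := one_sub_mul_qbinom_succ r k
    have h2 := qbinom_mul_pow_sub (r + k) k
    push_cast at h2 ⊢
    apply mul_left_cancel₀ (one_sub_q_pow_ne_zero k)
    linear_combination q ^ k * h1 + h2
  · rw [qbinom_of_lt (by omega) (by omega), qbinom_of_lt (by omega) (by omega),
      qbinom_of_lt (n := n) (k := k) (by omega) (by omega)]
    ring

/-- The coefficient of `x ^ r` in `Q_{r+m}`. -/
noncomputable def coeffQ (r m : ℕ) : K[X] :=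
  ((-1 : K) ^ m * q ^ (m * (m - 1) / 2)) •
    ∑ j ∈ range (m + 1),
      C (qbinom ((r : ℤ) + m - j) ((m : ℤ) - j) * qbinom ((r : ℤ) + j) j * q ^ ((r + 1) * j)) * X ^ j

theorem coeff_sum_C_mul_X_pow {R : Type*} [Semiring R] (f : ℕ → R) {N : ℕ}
    (hf : ∀ j, N ≤ j → f j = 0) (j : ℕ) : (∑ i ∈ range N, C (f i) * X ^ i).coeff j = f j := by
  simp only [finsetSum_coeff, coeff_C_mul_X_pow, sum_ite_eq, mem_range]
  split_ifs with h
  · rfl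
  · exact (hf j (not_lt.mp h)).symm

theorem coeff_coeffQ (r m j : ℕ) :
    (coeffQ r m).coeff j = (-1 : K) ^ m * q ^ (m * (m - 1) / 2) *
      (qbinom ((r : ℤ) + m - j) ((m : ℤ) - j) * qbinom ((r : ℤ) + j) j * q ^ ((r + 1) * j)) := by
  rw [coeffQ, coeff_smul, smul_eq_mul, coeff_sum_C_mul_X_pow]
  intro i hi
  rw [qbinom_of_neg _ (by omega)]
  ring

theorem coeffQ_zero (r : ℕ) : coeffQ r 0 = 1 := by
  simp [coeffQ]

theorem polyQ_eq_sum_coeffQ (k : ℕ) :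
    polyQ k = ∑ r ∈ range (k + 1), C (coeffQ r (k - r)) * X ^ r := by
  rw [← sum_range_reflect (fun r => C (coeffQ r (k - r)) * X ^ r), polyQ]
  refine sum_congr rfl fun m hm => ?_
  obtain ⟨r, rfl⟩ := Nat.exists_eq_add_of_le' (Nat.le_of_lt_succ (mem_range.mp hm))
  rw [show r + m + 1 - 1 - m = r by omega, show r + m - m = r by omega,
    show r + m - r = m by omega, coeffQ]
  congr 3
  refine sum_congr rfl fun j _ => ?_
  rw [show ((r + m : ℕ) : ℤ) - m + j = r + j by push_cast; ring, Nat.cast_add]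

theorem coeff_polyQ (k r : ℕ) : (polyQ k).coeff r = if r ≤ k then coeffQ r (k - r) else 0 := by
  simp [polyQ_eq_sum_coeffQ]

theorem sign_mul_pow_triangle_succ (m : ℕ) :
    (-1 : K) ^ (m + 1) * q ^ ((m + 1) * (m + 1 - 1) / 2) =
      -q ^ m * ((-1 : K) ^ m * q ^ (m * (m - 1) / 2)) := by
  rw [Nat.triangle_succ]
  ring

theorem coeffQ_one_recurrence (r : ℕ) :
    C (q ^ r - q ^ (r + 1)) * coeffQ r 1 =
      -(C (q ^ r * (1 - q ^ (r + 1))) * (1 + C (q ^ (r + 1)) * X) * coeffQ r 0) := by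
  have h0 := one_sub_mul_qbinom_succ r 0
  simp only [Nat.cast_zero, zero_add, add_zero, qbinom_zero_right] at h0
  simp only [coeffQ, sum_range_succ, sum_range_zero, smul_eq_C_mul]
  simp
  have h1 := congrArg (C : K → K[X]) h0
  simp only [map_mul, map_sub, map_one, map_pow] at h1 ⊢
  linear_combination -C q ^ r * (1 + C q ^ (r + 1) * X) * h1

/-- Recurrence in the degree for the coefficients of a fixed power of `x`. -/
theorem coeffQ_recurrence (r m : ℕ) :
    C (q ^ r - q ^ (r + m + 2)) * coeffQ r (m + 2) =
      -(C (q ^ (r + m + 1) * (1 - q ^ (r + m + 2))) * (1 + C (q ^ (r + 1)) * X) *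
          coeffQ r (m + 1)) -
        C (q ^ (2 * r + 2 * m + 2) * (1 - q ^ (2 * r + m + 2))) * X * coeffQ r m := by
  have hs1 := sign_mul_pow_triangle_succ m
  have hs2 := sign_mul_pow_triangle_succ (m + 1)
  ext j
  simp only [mul_add, add_mul, mul_one, mul_assoc, coeff_sub, coeff_neg, coeff_add, coeff_C_mul]
  rw [show m + 2 = m + 1 + 1 by ring]
  rcases j with _ | j
  · simp only [coeff_X_mul_zero, coeff_coeffQ, hs2, hs1]
    have h := pow_sub_mul_qbinom_sub r (m + 1) 0
    simp only [Nat.cast_zero, qbinom_zero_right] at h ⊢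
    generalize (-1 : K) ^ m * q ^ (m * (m - 1) / 2) = s
    linear_combination q ^ r * q ^ (m + 1) * q ^ m * s * h
  · simp only [coeff_X_mul, coeff_coeffQ, hs2, hs1]
    have h1 := pow_sub_mul_qbinom_sub r (m + 1) (j + 1)
    have h2 := one_sub_mul_qbinom_succ r j
    rw [show (r : ℤ) + (m + 1 : ℕ) - j = r + (m + 1 + 1 : ℕ) - (j + 1 : ℕ) by push_cast; ring,
      show ((m + 1 : ℕ) : ℤ) - j = (m + 1 + 1 : ℕ) - (j + 1 : ℕ) by push_cast; ring,
      show (r : ℤ) + m - j = r + (m + 1 : ℕ) - (j + 1 : ℕ) by push_cast; ring,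
      show (m : ℤ) - j = (m + 1 : ℕ) - (j + 1 : ℕ) by push_cast; ring,
      show (r : ℤ) + (j + 1 : ℕ) = r + j + 1 by push_cast; ring,
      show ((j + 1 : ℕ) : ℤ) = j + 1 by push_cast; ring] at *
    generalize (-1 : K) ^ m * q ^ (m * (m - 1) / 2) = s
    generalize qbinom ((r : ℤ) + (m + 1 + 1 : ℕ) - (j + 1)) ((m + 1 + 1 : ℕ) - (j + 1)) = g at *
    generalize qbinom ((r : ℤ) + (m + 1 : ℕ) - (j + 1)) ((m + 1 : ℕ) - (j + 1)) = g' at *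
    generalize qbinom ((r : ℤ) + j + 1) (j + 1) = f at *
    generalize qbinom ((r : ℤ) + j) j = f' at *
    linear_combination q ^ r * q ^ (m + 1) * q ^ m * s * q ^ ((r + 1) * (j + 1)) *
      ((f - q ^ r * f') * h1 + (g - g') * h2)

/-- Gaussian polynomials from which both `B_{n,k}` and its recurrence in `k` are built. -/
noncomputable def auxC (n k : ℕ) : K[X] :=
  ∑ j ∈ range (n + 1), C (q ^ (j * (j + k + 1)) * qbinom n j * qbinom n ((k : ℤ) + j)) * X ^ j

theorem coeff_auxC (n k j : ℕ) :
    (auxC n k).coeff j = q ^ (j * (j + k + 1)) * qbinom n j * qbinom n ((k : ℤ) + j) := by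
  rw [auxC, coeff_sum_C_mul_X_pow]
  intro i hi
  rw [qbinom_of_lt (n := n) (k := i) (by omega) (by omega)]
  ring

theorem auxC_of_lt {n k : ℕ} (h : n < k) : auxC n k = 0 := by
  ext j
  rw [coeff_auxC, qbinom_of_lt (k := (k : ℤ) + j) (by omega) (by omega), mul_zero, coeff_zero]

theorem auxC_self (n : ℕ) : auxC n n = 1 := by
  ext j
  rw [coeff_auxC, coeff_one]
  rcases j with _ | j
  · simp [qbinom_self]
  · rw [qbinom_of_lt (k := (n : ℤ) + (j + 1 : ℕ)) (by omega) (by omega)]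
    simp

theorem coeff_coeffB {n k : ℕ} (h : k ≤ n) (j : ℕ) :
    (coeffB n k).coeff j = q ^ (-((n : ℤ) - k)) * (q ^ (j ^ 2 + j + k * j) *
        (qbinom n j * qbinom ((n : ℤ) + 1) ((k : ℤ) + j + 1) -
         qbinom ((n : ℤ) + 1) j * qbinom n ((k : ℤ) + j + 1))) := by
  rw [coeffB, coeff_smul, smul_eq_mul, coeff_sum_C_mul_X_pow]
  intro i hi
  rw [qbinom_of_lt (k := (k : ℤ) + i + 1) (by omega) (by omega),
    qbinom_of_lt (k := (k : ℤ) + i + 1) (by omega) (by omega)]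
  ring

theorem coeff_zero_coeffB {n k : ℕ} (h : k ≤ n) : (coeffB n k).coeff 0 = qbinom n k := by
  have h1 := qbinom_succ_succ n k
  have := pow_ne_zero k q_ne_zero
  have := pow_ne_zero n q_ne_zero
  rw [coeff_coeffB h, neg_sub, zpow_sub₀ q_ne_zero, zpow_natCast, zpow_natCast]
  simp only [Nat.cast_zero, qbinom_zero_right, add_zero]
  field_simp
  linear_combination h1

theorem coeff_succ_coeffB {n k : ℕ} (h : k ≤ n) (j : ℕ) :
    (coeffB n k).coeff (j + 1) = q ^ ((j + 1) * (j + 1 + k)) *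
      (qbinom n ((j : ℤ) + 1) * qbinom n ((k : ℤ) + j + 1) -
        q ^ (k + 1) * qbinom n j * qbinom n ((k : ℤ) + j + 2)) := by
  have h1 := qbinom_succ_succ n (k + j + 1)
  have h2 := qbinom_succ_succ n j
  rw [coeff_coeffB h, neg_sub, zpow_sub₀ q_ne_zero, zpow_natCast, zpow_natCast]
  push_cast at *
  rw [show (k : ℤ) + (j + 1) + 1 = k + j + 2 by ring, show (k : ℤ) + j + 1 + 1 = k + j + 2 by ring]
    at *
  rw [div_mul_eq_mul_div, div_eq_iff (pow_ne_zero n q_ne_zero)]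
  linear_combination q ^ ((j + 1) * (j + 1 + k)) * (qbinom n ((j : ℤ) + 1) * h1
    - q ^ (k + 1) * qbinom n ((k : ℤ) + j + 2) * h2)

theorem coeffB_eq_auxC {n k : ℕ} (h : k ≤ n) :
    coeffB n k = auxC n k + C (q ^ (k + 1) * (1 - q ^ (k + 1))) * X * auxC n (k + 1) -
      C (q ^ (3 * k + 4)) * X * auxC n (k + 2) := by
  ext j
  simp only [mul_assoc, coeff_sub, coeff_add, coeff_C_mul]
  rcases j with _ | j
  · rw [coeff_zero_coeffB h]
    simp [coeff_auxC]
  · simp only [coeff_X_mul, coeff_auxC, coeff_succ_coeffB h]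
    have h1 := qbinom_mul_pow_sub n j
    have h2 := qbinom_mul_pow_sub n (k + j + 1)
    push_cast at *
    rw [show (k : ℤ) + (j + 1) = k + j + 1 by ring, show (k : ℤ) + 1 + j = k + j + 1 by ring,
      show (k : ℤ) + j + 1 + 1 = k + j + 2 by ring, show (k : ℤ) + 2 + j = k + j + 2 by ring] at *
    apply mul_left_cancel₀ (pow_ne_zero j q_ne_zero)
    linear_combination q ^ ((j + 1) * (j + 1 + k)) *
      (qbinom n j * h2 - qbinom n ((k : ℤ) + j + 1) * h1)

/-- Recurrence in `k` for the polynomials `auxC n k`. -/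
theorem auxC_recurrence {n k : ℕ} (h : k ≤ n) :
    C (q ^ k) * auxC n k - C (q ^ k * (1 - q ^ (k + 1))) * auxC n (k + 1) -
      C (q ^ (2 * k + 2)) * X * auxC n (k + 2) = C (q ^ n) * coeffB n k := by
  ext j
  simp only [mul_assoc, coeff_sub, coeff_C_mul]
  rcases j with _ | j
  · rw [coeff_zero_coeffB h]
    have h1 := qbinom_mul_pow_sub n k
    simp [coeff_auxC]
    linear_combination h1
  · simp only [coeff_X_mul, coeff_auxC, coeff_succ_coeffB h]
    have h1 := qbinom_mul_pow_sub n j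
    have h2 := qbinom_mul_pow_sub n (k + j + 1)
    push_cast at *
    rw [show (k : ℤ) + (j + 1) = k + j + 1 by ring, show (k : ℤ) + 1 + (j + 1) = k + j + 2 by ring,
      show (k : ℤ) + j + 1 + 1 = k + j + 2 by ring, show (k : ℤ) + 2 + j = k + j + 2 by ring] at *
    linear_combination q ^ ((j + 1) * (j + 1 + k)) *
      (qbinom n ((j : ℤ) + 1) * h2 - q ^ (k + 1) * qbinom n ((k : ℤ) + j + 2) * h1)

theorem sum_coeffB_mul_coeffQ_telescope (n r N : ℕ) (h : r + N + 1 ≤ n) :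
    C (q ^ r - q ^ n) * ∑ m ∈ range (N + 2), coeffB n (r + m) * coeffQ r m =
      C (q ^ (r + N + 1) * (1 - q ^ (r + N + 2))) * (1 + C (q ^ (r + 1)) * X) *
          auxC n (r + N + 2) * coeffQ r (N + 1) +
        C (q ^ (2 * r + 2 * N + 4) * (1 - q ^ (2 * r + N + 3))) * X *
          auxC n (r + N + 3) * coeffQ r (N + 1) +
        C (q ^ (2 * r + 2 * N + 2) * (1 - q ^ (2 * r + N + 2))) * X *
          auxC n (r + N + 2) * coeffQ r N := by
  induction N with
  | zero =>
    have a1 := coeffQ_one_recurrence r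
    have b0 := coeffB_eq_auxC (n := n) (k := r) (by omega)
    have c0 := auxC_recurrence (n := n) (k := r) (by omega)
    have b1 := coeffB_eq_auxC (n := n) (k := r + 1) (by omega)
    have c1 := auxC_recurrence (n := n) (k := r + 1) (by omega)
    simp only [zero_add, add_zero, mul_zero, sum_range_succ, sum_range_zero, map_mul, map_sub,
      map_one, map_pow, add_assoc, Nat.reduceAdd] at *
    linear_combination C q ^ r * coeffQ r 0 * b0 + C q ^ r * coeffQ r 1 * b1 + coeffQ r 0 * c0 +
      coeffQ r 1 * c1 + auxC n (r + 1) * a1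
  | succ N ih =>
    have a1 := coeffQ_recurrence r N
    have b1 := coeffB_eq_auxC (n := n) (k := r + N + 2) (by omega)
    have c1 := auxC_recurrence (n := n) (k := r + N + 2) (by omega)
    have ih := ih (by omega)
    rw [sum_range_succ]
    simp only [map_mul, map_sub, map_one, map_pow, add_assoc, Nat.reduceAdd] at *
    linear_combination ih + C q ^ r * coeffQ r (N + 2) * b1 + coeffQ r (N + 2) * c1 +
      auxC n (r + (N + 2)) * a1

theorem sum_coeffB_mul_coeffQ (r d : ℕ) :
    ∑ m ∈ range (d + 1), coeffB (r + d) (r + m) * coeffQ r m = if d = 0 then 1 else 0 := by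
  rcases d with _ | d
  · simp [coeffB_eq_auxC, auxC_of_lt, auxC_self, coeffQ_zero]
  · have h := sum_coeffB_mul_coeffQ_telescope (r + (d + 1)) r d le_rfl
    rw [auxC_of_lt (by omega), auxC_of_lt (by omega)] at h
    have hq : C (q ^ r - q ^ (r + (d + 1))) ≠ 0 := by
      rw [show q ^ r - q ^ (r + (d + 1)) = q ^ r * (1 - q ^ (d + 1)) by ring]
      exact C_ne_zero.mpr (mul_ne_zero (pow_ne_zero _ q_ne_zero) (one_sub_q_pow_ne_zero d))
    rw [if_neg d.succ_ne_zero]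
    exact (mul_eq_zero.mp (h.trans (by ring))).resolve_left hq

theorem X_pow_eq_sum_coeffB_mul_polyQ (n : ℕ) :
    (X : K[X][X]) ^ n = ∑ k ∈ range (n + 1), C (coeffB n k) * polyQ k := by
  ext1 r
  simp only [finsetSum_coeff, coeff_C_mul, coeff_polyQ, coeff_X_pow]
  rcases le_or_gt r n with h | h
  · obtain ⟨d, rfl⟩ := Nat.exists_eq_add_of_le h
    rw [add_assoc, sum_range_add, sum_eq_zero, zero_add]
    · simpa using (sum_coeffB_mul_coeffQ r d).symm
    · intro k hk
      rw [if_neg (by have := mem_range.mp hk; omega), mul_zero]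
  · rw [if_neg (by omega), sum_eq_zero]
    intro k hk
    rw [if_neg (by have := mem_range.mp hk; omega), mul_zero]

theorem coeffB_zero_right (n : ℕ) :
    coeffB n 0 = (qint (n + 1))⁻¹ • ∑ j ∈ range (n + 1),
      C (q ^ (j ^ 2) * qbinom ((n : ℤ) + 1) j * qbinom ((n : ℤ) + 1) ((j : ℤ) + 1)) * X ^ j := by
  have hn := one_sub_q_pow_ne_zero n
  have h1 : 1 - q ≠ 0 := by simpa using one_sub_q_pow_ne_zero 0
  ext j
  rw [coeff_smul, smul_eq_mul, coeff_sum_C_mul_X_pow (fun j => q ^ (j ^ 2) *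
    qbinom ((n : ℤ) + 1) j * qbinom ((n : ℤ) + 1) ((j : ℤ) + 1)), qint, inv_div,
    div_mul_eq_mul_div, eq_div_iff hn]
  · rcases j with _ | j
    · have h := one_sub_mul_qbinom_succ n 0
      rw [coeff_zero_coeffB n.zero_le]
      simp only [Nat.cast_zero, zero_add, add_zero, pow_one, qbinom_zero_right] at h ⊢
      linear_combination -h
    · rw [coeff_succ_coeffB n.zero_le]
      have h1 := qbinom_mul_pow_sub n j
      have h2 := qbinom_mul_pow_sub n (j + 1)
      have h3 := qbinom_succ_succ n j
      have h4 := qbinom_succ_succ n (j + 1)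
      push_cast at *
      simp only [zero_add, add_zero, add_assoc, Int.reduceAdd] at *
      apply mul_left_cancel₀ (pow_ne_zero j q_ne_zero)
      apply mul_left_cancel₀ (pow_ne_zero (j + 1) q_ne_zero)
      generalize qbinom n j = a at *
      generalize qbinom n ((j : ℤ) + 1) = b at *
      generalize qbinom n ((j : ℤ) + 2) = d at *
      generalize qbinom ((n : ℤ) + 1) ((j : ℤ) + 1) = e at *
      generalize qbinom ((n : ℤ) + 1) ((j : ℤ) + 2) = f at *
      linear_combination q ^ ((j + 1) * (j + 1)) *
        ((q ^ n * a + q ^ j * b) * h2 - q * (q ^ n * b + q ^ (j + 1) * d) * h1 -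
          (1 - q) * (q ^ (j + 1) * f * h3 + (q ^ j * b + q ^ n * a) * h4))
  · intro i hi
    rw [qbinom_of_lt (k := (i : ℤ) + 1) (by omega) (by omega), mul_zero]

/-- `x^n = ∑_{k=0}^{n} B_{n,k}(t,q) Q_k(x,t,q)` in `ℚ(q)[t][x]`, and
`B_{n,0}(t,q) = (1/[n+1]) ∑_{j=0}^{n} q^{j²} [n+1 choose j][n+1 choose j+1] t^j`. -/
theorem pow_eq_sum_polyQ (n : ℕ) :
    (Polynomial.X : Polynomial (Polynomial K)) ^ n =
      ∑ k ∈ Finset.range (n + 1), Polynomial.C (coeffB n k) * polyQ k ∧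
    coeffB n 0 = (qint (n + 1))⁻¹ •
      ∑ j ∈ Finset.range (n + 1),
        Polynomial.C (q ^ (j ^ 2) * qbinom ((n : ℤ) + 1) j * qbinom ((n : ℤ) + 1) ((j : ℤ) + 1)) *
          Polynomial.X ^ j :=
  ⟨X_pow_eq_sum_coeffB_mul_polyQ n, coeffB_zero_right n⟩
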